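/- Let B₁, …, B₁₄ be the following fourteen 7-element subsets of ℤ/589ℤ: {0,1,95,136,269,352,580}, {0,2,26,114,317,355,515}, {0,3,89,118,256,264,482}, {0,4,23,56,91,399,436}, {0,5,11,75,421,457,472}, {0,7,84,254,301,323,394}, {0,12,166,212,275,462,534}, {0,13,62,248,420,545,572}, {0,14,222,384,426,504,549}, {0,16,48,108,249,408,539}, {0,18,39,119,144,396,478}, {0,20,116,240,271,305,418}, {0,28,81,184,242,390,487}, {0,43,164,223,313,374,447}. Then the difference sets ΔB₁, …, ΔB₁₄ are pairwise disjoint, each has cardinality 42, and their union is (ℤ/589ℤ) \ {0}; consequently the translates {Bᵢ + g : 1 ≤ i ≤ 14, g ∈ ℤ/589ℤ} form the block set of a Steiner system S(2,7,589) on ℤ/589ℤ. -/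

import Mathlib

/-- The set of differences `ΔB = {a - c : a, c ∈ B, a ≠ c}`. -/
def diffSet (B : Finset (ZMod 589)) : Finset (ZMod 589) :=
  ((B ×ˢ B).filter fun p => p.1 ≠ p.2).image fun p => p.1 - p.2

/-- The 14 base blocks of the difference family on `ZMod 589`. -/
def baseBlocks : Fin 14 → Finset (ZMod 589) :=
  ![({0,1,95,136,269,352,580} : Finset (ZMod 589)),
   ({0,2,26,114,317,355,515} : Finset (ZMod 589)),
   ({0,3,89,118,256,264,482} : Finset (ZMod 589)),
   ({0,4,23,56,91,399,436} : Finset (ZMod 589)),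
   ({0,5,11,75,421,457,472} : Finset (ZMod 589)),
   ({0,7,84,254,301,323,394} : Finset (ZMod 589)),
   ({0,12,166,212,275,462,534} : Finset (ZMod 589)),
   ({0,13,62,248,420,545,572} : Finset (ZMod 589)),
   ({0,14,222,384,426,504,549} : Finset (ZMod 589)),
   ({0,16,48,108,249,408,539} : Finset (ZMod 589)),
   ({0,18,39,119,144,396,478} : Finset (ZMod 589)),
   ({0,20,116,240,271,305,418} : Finset (ZMod 589)),
   ({0,28,81,184,242,390,487} : Finset (ZMod 589)),
   ({0,43,164,223,313,374,447} : Finset (ZMod 589))]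

theorem diffSet_eq_image_offDiag (B : Finset (ZMod 589)) :
    diffSet B = B.offDiag.image fun p => p.1 - p.2 := by
  ext d
  simp only [diffSet, Finset.mem_image, Finset.mem_filter, Finset.mem_product,
    Finset.mem_offDiag, and_assoc]

theorem mem_diffSet {B : Finset (ZMod 589)} {d : ZMod 589} :
    d ∈ diffSet B ↔ ∃ a ∈ B, ∃ c ∈ B, a ≠ c ∧ a - c = d := by
  simp only [diffSet, Finset.mem_image, Finset.mem_filter, Finset.mem_product, Prod.exists]
  grind

theorem card_baseBlocks (i : Fin 14) : (baseBlocks i).card = 7 := by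
  revert i
  decide +kernel

/-- The residues in `[0, 589)` of the elements of the base blocks. -/
def baseBlockResidues : List (List ℕ) :=
  [[0, 1, 95, 136, 269, 352, 580],
   [0, 2, 26, 114, 317, 355, 515],
   [0, 3, 89, 118, 256, 264, 482],
   [0, 4, 23, 56, 91, 399, 436],
   [0, 5, 11, 75, 421, 457, 472],
   [0, 7, 84, 254, 301, 323, 394],
   [0, 12, 166, 212, 275, 462, 534],
   [0, 13, 62, 248, 420, 545, 572],
   [0, 14, 222, 384, 426, 504, 549],
   [0, 16, 48, 108, 249, 408, 539],
   [0, 18, 39, 119, 144, 396, 478],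
   [0, 20, 116, 240, 271, 305, 418],
   [0, 28, 81, 184, 242, 390, 487],
   [0, 43, 164, 223, 313, 374, 447]]

theorem coe_mem_baseBlocks (i : Fin 14) :
    ∀ n ∈ baseBlockResidues.getD i [], (n : ZMod 589) ∈ baseBlocks i := by
  revert i
  decide +kernel

theorem baseBlockResidues_differences :
    (List.range 589).all (fun d => baseBlockResidues.any fun l =>
      l.any fun c => l.any fun a => Nat.beq a ((c + d) % 589)) = true := by
  decide +kernel

theorem exists_add_mem_baseBlocks (d : ZMod 589) :
    ∃ i, ∃ c ∈ baseBlocks i, c + d ∈ baseBlocks i := by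
  have h := List.all_eq_true.mp baseBlockResidues_differences d.val
    (List.mem_range.mpr (ZMod.val_lt d))
  simp only [List.any_eq_true] at h
  obtain ⟨l, hl, c, hc, a, ha, hacd⟩ := h
  obtain ⟨k, hk, rfl⟩ := List.mem_iff_getElem.mp hl
  have hmem : ∀ n ∈ baseBlockResidues[k], (n : ZMod 589) ∈ baseBlocks ⟨k, hk⟩ := fun n hn =>
    coe_mem_baseBlocks ⟨k, hk⟩ n (by rwa [List.getD_eq_getElem _ _ hk])
  refine ⟨⟨k, hk⟩, c, hmem c hc, ?_⟩
  have := hmem a ha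
  rwa [Nat.eq_of_beq_eq_true hacd, ZMod.natCast_mod, Nat.cast_add, ZMod.natCast_zmod_val] at this

/-- Distinct ordered pairs of distinct elements of base blocks have distinct differences. -/
theorem baseBlocks_sub_injective {i j : Fin 14} {a c a' c' : ZMod 589}
    (ha : a ∈ baseBlocks i) (hc : c ∈ baseBlocks i) (hac : a ≠ c)
    (ha' : a' ∈ baseBlocks j) (hc' : c' ∈ baseBlocks j) (h : a - c = a' - c') :
    i = j ∧ a = a' ∧ c = c' := by
  have hac' : a' ≠ c' := fun e => hac (sub_eq_zero.mp (by rw [h, e, sub_self]))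
  let S : Finset (Σ _ : Fin 14, ZMod 589 × ZMod 589) :=
    Finset.univ.sigma fun i => (baseBlocks i).offDiag
  let f : (Σ _ : Fin 14, ZMod 589 × ZMod 589) → ZMod 589 := fun x => x.2.1 - x.2.2
  have hS : ∀ {k x y}, x ∈ baseBlocks k → y ∈ baseBlocks k → x ≠ y → (⟨k, x, y⟩ : Σ _, _) ∈ S :=
    fun hx hy hxy => Finset.mem_sigma.mpr
      ⟨Finset.mem_univ _, Finset.mem_offDiag.mpr ⟨hx, hy, hxy⟩⟩
  have hsub : Finset.univ.erase 0 ⊆ S.image f := by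
    intro d hd
    obtain ⟨k, y, hy, hyd⟩ := exists_add_mem_baseBlocks d
    exact Finset.mem_image.mpr ⟨⟨k, y + d, y⟩,
      hS hyd hy (by simpa using Finset.ne_of_mem_erase hd), add_sub_cancel_left y d⟩
  have hcard : S.card = 588 := by
    simp [S, Finset.card_sigma, Finset.offDiag_card, card_baseBlocks]
  have hinj : Set.InjOn f S := by
    refine Finset.card_image_iff.mp (le_antisymm Finset.card_image_le ?_)
    have := Finset.card_le_card hsub
    rwa [Finset.card_erase_of_mem (Finset.mem_univ _), Finset.card_univ, ZMod.card,
      show 589 - 1 = S.card from hcard.symm] at this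
  have := hinj (hS ha hc hac) (hS ha' hc' hac') h
  simpa using this


/-- The given 14 base blocks form a difference family on `ℤ/589ℤ`: their difference
sets are pairwise disjoint, each has 42 elements, and their union is `ℤ/589ℤ \ {0}`;
consequently the translates `Bᵢ + g` form the block set of a Steiner system
`S(2,7,589)` on `ℤ/589ℤ`. -/
theorem difference_family_zmod_589_9 :
    (∀ i j, i ≠ j → Disjoint (diffSet (baseBlocks i)) (diffSet (baseBlocks j))) ∧
    (∀ i, (diffSet (baseBlocks i)).card = 42) ∧
    ((Finset.univ.biUnion fun i => diffSet (baseBlocks i)) = Finset.univ \ {0}) ∧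
    ∀ p : Finset (ZMod 589), p.card = 2 →
      ∃! b, b ∈ (Finset.univ.image fun ig : Fin 14 × ZMod 589 =>
          (baseBlocks ig.1).image (· + ig.2)) ∧ p ⊆ b := by
  refine ⟨fun i j hij => Finset.disjoint_left.mpr fun d hi hj => ?_, fun i => ?_, ?_, ?_⟩
  · obtain ⟨a, ha, c, hc, hac, rfl⟩ := mem_diffSet.mp hi
    obtain ⟨a', ha', c', hc', -, h⟩ := mem_diffSet.mp hj
    exact hij (baseBlocks_sub_injective ha hc hac ha' hc' h.symm).1
  · rw [diffSet_eq_image_offDiag, Finset.card_image_of_injOn, Finset.offDiag_card,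
      card_baseBlocks]
    rintro ⟨a, c⟩ hp ⟨a', c'⟩ hp' h
    simp only [Finset.mem_coe, Finset.mem_offDiag] at hp hp'
    obtain ⟨-, rfl, rfl⟩ := baseBlocks_sub_injective hp.1 hp.2.1 hp.2.2 hp'.1 hp'.2.1 h
    rfl
  · ext d
    simp only [Finset.mem_biUnion, Finset.mem_univ, true_and, mem_diffSet, Finset.mem_sdiff,
      Finset.mem_singleton]
    constructor
    · rintro ⟨i, a, -, c, -, hac, rfl⟩
      exact sub_ne_zero.mpr hac
    · intro hd
      obtain ⟨i, c, hc, hcd⟩ := exists_add_mem_baseBlocks d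
      exact ⟨i, c + d, hcd, c, hc, by simpa using hd, add_sub_cancel_left c d⟩
  · intro p hp
    obtain ⟨x, y, hxy, rfl⟩ := Finset.card_eq_two.mp hp
    have mem_translate {B : Finset (ZMod 589)} {g z : ZMod 589} :
        z ∈ B.image (· + g) ↔ z - g ∈ B := by
      simp [sub_eq_add_neg]
    obtain ⟨i, c, hc, ha⟩ := exists_add_mem_baseBlocks (x - y)
    refine ⟨(baseBlocks i).image (· + (y - c)), ⟨?_, ?_⟩, ?_⟩
    · exact Finset.mem_image.mpr ⟨(i, y - c), Finset.mem_univ _, rfl⟩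
    · rw [Finset.insert_subset_iff, Finset.singleton_subset_iff, mem_translate, mem_translate,
        sub_sub_cancel, show x - (y - c) = c + (x - y) by ring]
      exact ⟨ha, hc⟩
    · rintro b ⟨hb, hpb⟩
      obtain ⟨⟨j, h⟩, -, rfl⟩ := Finset.mem_image.mp hb
      rw [Finset.insert_subset_iff, Finset.singleton_subset_iff, mem_translate,
        mem_translate] at hpb
      obtain ⟨rfl, -, hy⟩ := baseBlocks_sub_injective hpb.1 hpb.2 (by simpa using hxy) ha hc
        (by ring)
      rw [← hy, sub_sub_cancel]
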